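/- arXiv:1311.0977 — 2 statements merged into one kernel-verified Lean document; each statement's English description precedes it below -/
import Mathlib

section
/- Let ξ > 0 and K ≥ 0. Let c¹, b ∈ ℂ³ and d̃ ∈ ℂ satisfy |b| ≤ K and |d̃| ≤ K|c¹|. Define for t ≤ 1: c(t) = (c¹ − 2π√ξ (t−1) d̃ b) e^{2π√ξ (t−1)} and d(t) = −4π√ξ d̃ e^{2π√ξ (t−1)}. Then for all t ≤ 1: |c(t)| + |t−1| |d(t)| ≤ (1 + 2K²/e + 4K/e) |c¹| e^{π√ξ (t−1)}. -/
open MeasureTheory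

/-- Exponential decay estimate (3.16) for the nonzero Fourier modes of the boundary layer
velocity and pressure: the explicit modes decay at half the exponential rate `2π√ξ`, with a
constant depending only on the bound `K` for the geometric data, uniformly in `ξ`. -/
theorem stmt_5 (ξ K : ℝ) (hξ : 0 < ξ) (hK : 0 ≤ K)
    (c1 b : EuclideanSpace ℂ (Fin 3)) (dt : ℂ)
    (hb : ‖b‖ ≤ K) (hdt : ‖dt‖ ≤ K * ‖c1‖)
    (c : ℝ → EuclideanSpace ℂ (Fin 3)) (d : ℝ → ℂ)
    (hc : ∀ t ≤ (1:ℝ), c t = Real.exp (2 * Real.pi * Real.sqrt ξ * (t - 1)) •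
        (c1 - (((2 * Real.pi * Real.sqrt ξ * (t - 1) : ℝ) : ℂ) * dt) • b))
    (hd : ∀ t ≤ (1:ℝ), d t =
        (-(4 * Real.pi * Real.sqrt ξ) * Real.exp (2 * Real.pi * Real.sqrt ξ * (t - 1))) • dt) :
    ∀ t ≤ (1:ℝ), ‖c t‖ + |t - 1| * ‖d t‖ ≤
      (1 + 2 * K ^ 2 / Real.exp 1 + 4 * K / Real.exp 1) * ‖c1‖ *
        Real.exp (Real.pi * Real.sqrt ξ * (t - 1)) := by
  intro t ht
  obtain ⟨s, hs⟩ : ∃ s, s = Real.pi * Real.sqrt ξ * (1 - t) := ⟨_, rfl⟩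
  have hs0 : 0 ≤ s := hs ▸ mul_nonneg (by positivity) (sub_nonneg.2 ht)
  have hsE : s * Real.exp (-s) ≤ 1 / Real.exp 1 := by
    rw [one_div, ← Real.exp_neg]
    exact Real.mul_exp_neg_le_exp_neg_one s
  have hE1 : Real.exp (-s) ≤ 1 := Real.exp_le_one_iff.2 (by linarith)
  have hexp : Real.exp (2 * Real.pi * Real.sqrt ξ * (t - 1)) =
      Real.exp (-s) * Real.exp (-s) := by
    rw [← Real.exp_add, hs]; ring_nf
  have hcoef : 2 * Real.pi * Real.sqrt ξ * (t - 1) = -(2 * s) := by rw [hs]; ring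
  have hrate : Real.pi * Real.sqrt ξ * (t - 1) = -s := by rw [hs]; ring
  have hbdt : ‖dt‖ * ‖b‖ ≤ K * ‖c1‖ * K := by gcongr
  have hcn : ‖c t‖ ≤ Real.exp (-s) * Real.exp (-s) * (‖c1‖ + 2 * s * (‖dt‖ * ‖b‖)) := by
    rw [hc t ht, hexp, hcoef, norm_smul, Real.norm_of_nonneg (by positivity)]
    gcongr
    refine (norm_sub_le _ _).trans_eq ?_
    rw [norm_smul, norm_mul, Complex.norm_real, norm_neg, Real.norm_of_nonneg (by positivity),
      mul_assoc]
  have hdn : |t - 1| * ‖d t‖ = 4 * s * (Real.exp (-s) * Real.exp (-s)) * ‖dt‖ := by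
    rw [hd t ht, hexp, norm_smul, norm_mul, norm_neg, Real.norm_of_nonneg (by positivity),
      Real.norm_of_nonneg (by positivity), abs_of_nonpos (by linarith), hs]
    ring
  rw [hrate]
  have hE0 : 0 ≤ Real.exp (-s) := Real.exp_nonneg _
  generalize Real.exp (-s) = E at *
  calc ‖c t‖ + |t - 1| * ‖d t‖
      ≤ E * E * (‖c1‖ + 2 * s * (‖dt‖ * ‖b‖)) + 4 * s * (E * E) * ‖dt‖ := by
        rw [hdn]; gcongr
    _ = (E * ‖c1‖ + 2 * (s * E) * (‖dt‖ * ‖b‖) + 4 * (s * E) * ‖dt‖) * E := by ring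
    _ ≤ (1 * ‖c1‖ + 2 * (1 / Real.exp 1) * (K * ‖c1‖ * K) +
          4 * (1 / Real.exp 1) * (K * ‖c1‖)) * E := by gcongr
    _ = _ := by ring
end

section
/- Let α > 0 and K ≥ 0. For each m ∈ ℤ² with m ≠ 0, let ξ_m ≥ (α²/π²)|m|², let c_m¹, b_m ∈ ℂ³ and d̃_m ∈ ℂ with |b_m| ≤ K and |d̃_m| ≤ K|c_m¹|, and assume S² := ∑_{m ≠ 0} |c_m¹|² < ∞. Define for t ≤ 1: c_m(t) = (c_m¹ − 2π√(ξ_m) (t−1) d̃_m b_m) e^{2π√(ξ_m) (t−1)}. Then there is a constant C depending only on K (for instance C = 1 + 2K²/e + 4K/e) such that for every t ≤ 1 the series ∑_{m ≠ 0} |c_m(t)|² converges and (∑_{m ≠ 0} |c_m(t)|²)^{1/2} ≤ C e^{α(t−1)} S. -/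
open MeasureTheory

/-- A linear factor is absorbed by half of the exponential decay rate. -/
lemma one_add_mul_mul_exp_neg_le {A x y : ℝ} (hA : 0 ≤ A) (hx : 0 ≤ x) (hy : 2 * y ≤ x) :
    (1 + x * A) * Real.exp (-x) ≤ (1 + 2 * A / Real.exp 1) * Real.exp (-y) := by
  have hlin : x * Real.exp (-(x / 2)) ≤ 2 / Real.exp 1 := by
    have h := Real.add_one_le_exp (x / 2 - 1)
    have hprod : Real.exp (x / 2 - 1) * Real.exp (-(x / 2)) = 1 / Real.exp 1 := by
      rw [← Real.exp_add, one_div, ← Real.exp_neg]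
      ring_nf
    have h' := mul_le_mul_of_nonneg_right h (Real.exp_pos (-(x / 2))).le
    rw [hprod] at h'
    rw [div_eq_mul_one_div 2 (Real.exp 1)]
    linarith
  have hone : Real.exp (-(x / 2)) ≤ 1 := Real.exp_le_one_iff.2 (by linarith)
  have hhalf : (1 + x * A) * Real.exp (-(x / 2)) ≤ 1 + 2 * A / Real.exp 1 := by
    have h := mul_le_mul_of_nonneg_left hlin hA
    have hdiv : A * (2 / Real.exp 1) = 2 * A / Real.exp 1 := by ring
    linarith
  have hsplit : Real.exp (-x) = Real.exp (-(x / 2)) * Real.exp (-(x / 2)) := by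
    rw [← Real.exp_add]
    ring_nf
  rw [hsplit, ← mul_assoc]
  gcongr
  linarith

/-- A nonzero integer vector has squared Euclidean norm at least one. -/
lemma one_le_sq_add_sq_of_ne_zero {m : ℤ × ℤ} (hm : m ≠ 0) :
    (1 : ℝ) ≤ (m.1 : ℝ) ^ 2 + (m.2 : ℝ) ^ 2 := by
  have h : 0 < m.1 ^ 2 + m.2 ^ 2 := by
    by_contra! hle
    apply hm
    ext
    · exact pow_eq_zero_iff two_ne_zero |>.1 (by nlinarith [sq_nonneg m.1, sq_nonneg m.2])
    · exact pow_eq_zero_iff two_ne_zero |>.1 (by nlinarith [sq_nonneg m.1, sq_nonneg m.2])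
  exact_mod_cast h

/-- A pointwise bound by a constant multiple passes to `ℓ²` norms. -/
lemma summable_sq_and_sqrt_tsum_sq_le {ι : Type*} {f g : ι → ℝ} {M : ℝ} (hM : 0 ≤ M)
    (hf : ∀ i, 0 ≤ f i) (hfg : ∀ i, f i ≤ M * g i) (hg : Summable fun i => g i ^ 2) :
    (Summable fun i => f i ^ 2) ∧ √(∑' i, f i ^ 2) ≤ M * √(∑' i, g i ^ 2) := by
  have hle : ∀ i, f i ^ 2 ≤ M ^ 2 * g i ^ 2 := fun i => by
    rw [← mul_pow]
    exact pow_le_pow_left₀ (hf i) (hfg i) 2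
  have hsum : Summable fun i => f i ^ 2 :=
    (hg.mul_left (M ^ 2)).of_nonneg_of_le (fun i => sq_nonneg _) hle
  refine ⟨hsum, ?_⟩
  calc √(∑' i, f i ^ 2) ≤ √(M ^ 2 * ∑' i, g i ^ 2) := by
        rw [← tsum_mul_left]
        exact Real.sqrt_le_sqrt (hsum.tsum_le_tsum hle (hg.mul_left _))
    _ = M * √(∑' i, g i ^ 2) := by rw [Real.sqrt_mul (sq_nonneg M), Real.sqrt_sq hM]

/-- The `ℓ²`-summed exponential decay estimate (3.18) for the boundary layer: by Parseval's
identity, the left-hand side is the `L²` norm over the periodicity cell of the oscillatory part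
of the boundary layer velocity at height `t`, and it decays exponentially at rate `α` as
`t → −∞`, with constant depending only on the bound `K` for the geometric data. -/
theorem stmt_6 (α K : ℝ) (hα : 0 < α) (hK : 0 ≤ K)
    (ξ : ℤ × ℤ → ℝ) (c1 b : ℤ × ℤ → EuclideanSpace ℂ (Fin 3)) (dt : ℤ × ℤ → ℂ)
    (hξ : ∀ m : ℤ × ℤ, m ≠ 0 →
      (α ^ 2 / Real.pi ^ 2) * ((m.1 : ℝ) ^ 2 + (m.2 : ℝ) ^ 2) ≤ ξ m)
    (hb : ∀ m : ℤ × ℤ, m ≠ 0 → ‖b m‖ ≤ K)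
    (hdt : ∀ m : ℤ × ℤ, m ≠ 0 → ‖dt m‖ ≤ K * ‖c1 m‖)
    (hS : Summable fun m : {m : ℤ × ℤ // m ≠ 0} => ‖c1 m.1‖ ^ 2)
    (c : ℤ × ℤ → ℝ → EuclideanSpace ℂ (Fin 3))
    (hc : ∀ m : ℤ × ℤ, m ≠ 0 → ∀ t ≤ (1:ℝ),
      c m t = Real.exp (2 * Real.pi * Real.sqrt (ξ m) * (t - 1)) •
        (c1 m - (((2 * Real.pi * Real.sqrt (ξ m) * (t - 1) : ℝ) : ℂ) * dt m) • b m)) :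
    ∀ t ≤ (1:ℝ),
      (Summable fun m : {m : ℤ × ℤ // m ≠ 0} => ‖c m.1 t‖ ^ 2) ∧
      Real.sqrt (∑' m : {m : ℤ × ℤ // m ≠ 0}, ‖c m.1 t‖ ^ 2) ≤
        (1 + 2 * K ^ 2 / Real.exp 1 + 4 * K / Real.exp 1) * Real.exp (α * (t - 1)) *
          Real.sqrt (∑' m : {m : ℤ × ℤ // m ≠ 0}, ‖c1 m.1‖ ^ 2) := by
  intro t ht
  refine summable_sq_and_sqrt_tsum_sq_le (f := fun m : {m : ℤ × ℤ // m ≠ 0} => ‖c m.1 t‖)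
    (g := fun m : {m : ℤ × ℤ // m ≠ 0} => ‖c1 m.1‖) (by positivity)
    (fun _ => norm_nonneg _) ?_ hS
  rintro ⟨m, hm⟩
  have hsqrt : α / Real.pi ≤ √(ξ m) := by
    apply Real.le_sqrt_of_sq_le
    rw [div_pow]
    exact (le_mul_of_one_le_right (by positivity) (one_le_sq_add_sq_of_ne_zero hm)).trans
      (hξ m hm)
  have hrate : α ≤ Real.pi * √(ξ m) := by
    rwa [div_le_iff₀' Real.pi_pos] at hsqrt
  obtain ⟨x, hx⟩ : ∃ x, x = 2 * Real.pi * √(ξ m) * (1 - t) := ⟨_, rfl⟩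
  have hx_neg : 2 * Real.pi * √(ξ m) * (t - 1) = -x := by rw [hx]; ring
  have hx_nonneg : 0 ≤ x := by
    rw [hx]
    exact mul_nonneg (by positivity) (by linarith)
  have hx_lower : 2 * (α * (1 - t)) ≤ x := by
    rw [hx]
    nlinarith [mul_le_mul_of_nonneg_right hrate (sub_nonneg.2 ht)]
  have hprod : ‖dt m‖ * ‖b m‖ ≤ K * ‖c1 m‖ * K :=
    mul_le_mul (hdt m hm) (hb m hm) (norm_nonneg _) (by positivity)
  have hvec : ‖c1 m - (((-x : ℝ) : ℂ) * dt m) • b m‖ ≤ (1 + x * K ^ 2) * ‖c1 m‖ := by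
    refine (norm_sub_le _ _).trans ?_
    rw [norm_smul, norm_mul, Complex.norm_real, Real.norm_eq_abs, abs_neg,
      abs_of_nonneg hx_nonneg]
    nlinarith [mul_le_mul_of_nonneg_left hprod hx_nonneg]
  have hdecay := one_add_mul_mul_exp_neg_le (sq_nonneg K) hx_nonneg hx_lower
  have hneg : -(α * (1 - t)) = α * (t - 1) := by ring
  rw [hneg] at hdecay
  have hconst : 1 + 2 * K ^ 2 / Real.exp 1 ≤
      1 + 2 * K ^ 2 / Real.exp 1 + 4 * K / Real.exp 1 :=
    le_add_of_nonneg_right (by positivity)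
  change ‖c m t‖ ≤ _ * ‖c1 m‖
  rw [hc m hm t ht, hx_neg, norm_smul, Real.norm_eq_abs, Real.abs_exp]
  calc Real.exp (-x) * ‖c1 m - (((-x : ℝ) : ℂ) * dt m) • b m‖
      ≤ Real.exp (-x) * ((1 + x * K ^ 2) * ‖c1 m‖) := by gcongr
    _ = (1 + x * K ^ 2) * Real.exp (-x) * ‖c1 m‖ := by ring
    _ ≤ _ := mul_le_mul_of_nonneg_right
        (hdecay.trans (mul_le_mul_of_nonneg_right hconst (Real.exp_pos _).le)) (norm_nonneg _)
end
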